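/- Let x = (x_n)_{n∈ℕ} be a sequence in the space c₀ of real sequences converging to zero (with the supremum norm), and suppose that B(x) is tall. Then there exists a 2-coloring c of the 2-element subsets of ℕ with colors {0,1} such that: (a) the relation defined by m ≺ n iff (m < n and c({m,n}) = 1) is transitive; (b) every 0-homogeneous subset of ℕ is finite; and (c) every c-homogeneous subset of ℕ belongs to B(x). -/

import Mathlib

open scoped ZeroAtInfty

/-- `B(x)`: the family of all `A ⊆ ℕ` such that
`sup {‖∑_{n ∈ F} x n‖ : F finite, F ⊆ A} < ∞`. -/
noncomputable def BIdeal {X : Type*} [NormedAddCommGroup X] (x : ℕ → X) : Set (Set ℕ) :=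
  {A | ∃ C : ℝ, ∀ F : Finset ℕ, (↑F : Set ℕ) ⊆ A → ‖∑ n ∈ F, x n‖ ≤ C}

/-- A family of subsets of `ℕ` is tall if every infinite subset of `ℕ`
has an infinite subset belonging to the family. -/
def Tall (I : Set (Set ℕ)) : Prop :=
  ∀ A : Set ℕ, A.Infinite → ∃ B ⊆ A, B.Infinite ∧ B ∈ I

theorem BIdeal.of_finite {X : Type*} [NormedAddCommGroup X] (x : ℕ → X) {A : Set ℕ}
    (hA : A.Finite) : A ∈ BIdeal x := by
  refine ⟨∑ n ∈ hA.toFinset, ‖x n‖, fun F hF => (norm_sum_le _ _).trans ?_⟩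
  exact Finset.sum_le_sum_of_subset_of_nonneg (fun n hn => hA.mem_toFinset.2 (hF hn))
    fun _ _ _ => norm_nonneg _

theorem C0.norm_apply_le (f : C₀(ℕ, ℝ)) (k : ℕ) : |f k| ≤ ‖f‖ :=
  f.toBCF.norm_coe_le_norm k

theorem C0.norm_le_of_forall {f : C₀(ℕ, ℝ)} {C : ℝ} (hC : 0 ≤ C) (h : ∀ k, |f k| ≤ C) :
    ‖f‖ ≤ C :=
  (BoundedContinuousFunction.norm_le (f := f.toBCF) hC).2 h

theorem C0.sum_apply (x : ℕ → C₀(ℕ, ℝ)) (F : Finset ℕ) (k : ℕ) :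
    (∑ n ∈ F, x n) k = ∑ n ∈ F, x n k := by
  induction F using Finset.induction_on with
  | empty => simp
  | insert a F ha ih => simp [Finset.sum_insert ha, ih]

/-- If `B(x)` is tall, then `x` is bounded. -/
theorem Tall.exists_norm_le {X : Type*} [NormedAddCommGroup X] {x : ℕ → X}
    (htall : Tall (BIdeal x)) : ∃ M : ℝ, ∀ n, ‖x n‖ ≤ M := by
  by_contra! h
  have hfreq : ∀ i : ℕ, ∃ᶠ n in Filter.atTop, (i : ℝ) < ‖x n‖ := by
    intro i hi
    obtain ⟨N, hN⟩ := Filter.eventually_atTop.1 hi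
    obtain ⟨n, hn⟩ := h (i + ∑ j ∈ Finset.range N, ‖x j‖)
    have hsum : 0 ≤ ∑ j ∈ Finset.range N, ‖x j‖ := Finset.sum_nonneg fun _ _ => norm_nonneg _
    rcases lt_or_ge n N with hlt | hge
    · have := Finset.single_le_sum (f := fun j => ‖x j‖) (fun _ _ => norm_nonneg _)
        (Finset.mem_range.2 hlt)
      have hi0 : (0 : ℝ) ≤ i := i.cast_nonneg
      linarith
    · exact hN n hge (by linarith)
  obtain ⟨φ, hφ, hlt⟩ := Filter.extraction_forall_of_frequently hfreq
  obtain ⟨B, hBA, hB, C, hC⟩ := htall (Set.range φ) (Set.infinite_range_of_injective hφ.injective)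
  refine hB (((Set.finite_Iio ⌈C⌉₊).image φ).subset ?_)
  intro n hn
  obtain ⟨i, rfl⟩ := hBA hn
  have hle := hC {φ i} (by simpa using hn)
  rw [Finset.sum_singleton] at hle
  exact ⟨i, Nat.lt_ceil.2 ((hlt i).trans_le hle), rfl⟩

/-- If `B(x)` is tall, then every coordinate of `x n` tends to zero. -/
theorem Tall.finite_lt_abs {x : ℕ → C₀(ℕ, ℝ)} (htall : Tall (BIdeal x)) (k : ℕ) {ε : ℝ}
    (hε : 0 < ε) : {n | ε < |x n k|}.Finite := by
  have hsign : ∀ s : ℝ, |s| = 1 → {n | ε < s * x n k}.Finite := by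
    intro s hs
    by_contra hinf
    obtain ⟨B, hBA, hB, C, hC⟩ := htall _ hinf
    obtain ⟨N, hN⟩ := exists_nat_gt (C / ε)
    obtain ⟨F, hFB, hF⟩ := hB.exists_subset_card_eq N
    have hlow : N * ε ≤ ∑ n ∈ F, s * x n k := by
      rw [← hF, ← nsmul_eq_mul]
      exact Finset.card_nsmul_le_sum _ _ _ fun n hn => le_of_lt (hBA (hFB hn))
    have hup : ∑ n ∈ F, s * x n k ≤ C := by
      rw [← Finset.mul_sum, ← C0.sum_apply]
      refine (le_abs_self _).trans ?_
      rw [abs_mul, hs, one_mul]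
      exact (C0.norm_apply_le _ k).trans (hC F hFB)
    rw [div_lt_iff₀ hε] at hN
    linarith
  refine ((hsign 1 (by simp)).union (hsign (-1) (by simp))).subset ?_
  intro n hn
  rcases lt_abs.1 (Set.mem_ofPred.1 hn) with h | h
  · left; simpa using h
  · right; simpa using h

/-- The coordinate `k` is active at stage `m` if some `x i` with `i ≤ m` exceeds `2⁻ⁱ` there. -/
def Active (x : ℕ → C₀(ℕ, ℝ)) (m k : ℕ) : Prop := ∃ i ≤ m, (1 / 2 : ℝ) ^ i < |x i k|

/-- `n` comes after `m` and `x n` is at most `2⁻ᵐ` on the coordinates active at stage `m`. -/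
def Precedes (x : ℕ → C₀(ℕ, ℝ)) (m n : ℕ) : Prop :=
  m < n ∧ ∀ k, Active x m k → |x n k| ≤ (1 / 2 : ℝ) ^ m

theorem Active.mono {x : ℕ → C₀(ℕ, ℝ)} {m n k : ℕ} (h : Active x m k) (hmn : m ≤ n) :
    Active x n k :=
  let ⟨i, hi, hik⟩ := h
  ⟨i, hi.trans hmn, hik⟩

theorem Precedes.trans {x : ℕ → C₀(ℕ, ℝ)} {l m n : ℕ} (hlm : Precedes x l m)
    (hmn : Precedes x m n) : Precedes x l n :=
  ⟨hlm.1.trans hmn.1, fun k hk => (hmn.2 k (hk.mono hlm.1.le)).trans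
    (pow_le_pow_of_le_one (by norm_num) (by norm_num) hlm.1.le)⟩

theorem finite_active (x : ℕ → C₀(ℕ, ℝ)) (m : ℕ) : {k | Active x m k}.Finite := by
  have h : ∀ i, {k | (1 / 2 : ℝ) ^ i < |x i k|}.Finite := by
    intro i
    have hz := (zero_at_infty (x i)).abs
    rw [abs_zero, Filter.cocompact_eq_cofinite] at hz
    have := hz.eventually (gt_mem_nhds (show (0 : ℝ) < (1 / 2) ^ i by positivity))
    refine (Filter.eventually_cofinite.1 this).subset fun k hk => ?_
    exact not_lt.2 (le_of_lt hk)
  refine ((Set.finite_Iic m).biUnion fun i _ => h i).subset ?_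
  rintro k ⟨i, hi, hk⟩
  exact Set.mem_biUnion hi hk

theorem Tall.finite_not_precedes {x : ℕ → C₀(ℕ, ℝ)} (htall : Tall (BIdeal x)) (m : ℕ) :
    {n | ¬ Precedes x m n}.Finite := by
  refine ((Set.finite_Iic m).union ((finite_active x m).biUnion fun k _ =>
    htall.finite_lt_abs k (show (0 : ℝ) < (1 / 2) ^ m by positivity))).subset ?_
  intro n hn
  by_contra hcon
  simp only [Set.mem_union, Set.mem_Iic, Set.mem_iUnion, Set.mem_ofPred_eq, not_or, not_le,
    not_exists, not_lt] at hcon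
  exact hn ⟨hcon.1, fun k hk => hcon.2 k hk⟩

theorem sum_abs_le_of_active {x : ℕ → C₀(ℕ, ℝ)} {k : ℕ} (F : Finset ℕ)
    (hF : ∀ m ∈ F, ∀ n ∈ F, m < n → Precedes x m n) :
    ∀ a, Active x a k → (∀ n ∈ F, Precedes x a n) →
      ∑ n ∈ F, |x n k| ≤ 2 * (1 / 2 : ℝ) ^ a := by
  induction F using Finset.induction_on_min with
  | empty => intro a _ _; simp
  | insert b F hb ih =>
    intro a ha haF
    have hab := haF b (Finset.mem_insert_self b F)
    have hrest := ih (fun m hm n hn => hF m (Finset.mem_insert_of_mem hm) n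
      (Finset.mem_insert_of_mem hn)) b (ha.mono hab.1.le) fun n hn =>
        hF b (Finset.mem_insert_self b F) n (Finset.mem_insert_of_mem hn) (hb n hn)
    have hpow : (1 / 2 : ℝ) ^ b ≤ (1 / 2) ^ (a + 1) :=
      pow_le_pow_of_le_one (by norm_num) (by norm_num) hab.1
    rw [pow_succ] at hpow
    rw [Finset.sum_insert fun h => lt_irrefl b (hb b h)]
    linarith [hab.2 k ha]

theorem sum_abs_le_of_chain {x : ℕ → C₀(ℕ, ℝ)} {k : ℕ} {M : ℝ} (hM : ∀ n, ‖x n‖ ≤ M)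
    (F : Finset ℕ) (hF : ∀ m ∈ F, ∀ n ∈ F, m < n → Precedes x m n) :
    ∀ a, (∀ n ∈ F, a ≤ n) → ∑ n ∈ F, |x n k| ≤ M + 2 + 2 * (1 / 2 : ℝ) ^ a := by
  have hM0 : 0 ≤ M := (norm_nonneg _).trans (hM 0)
  induction F using Finset.induction_on_min with
  | empty => intro a _; rw [Finset.sum_empty]; positivity
  | insert b F hb ih =>
    intro a haF
    have hpow : (1 / 2 : ℝ) ^ b ≤ (1 / 2) ^ a :=
      pow_le_pow_of_le_one (by norm_num) (by norm_num) (haF b (Finset.mem_insert_self b F))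
    have hchain : ∀ m ∈ F, ∀ n ∈ F, m < n → Precedes x m n := fun m hm n hn =>
      hF m (Finset.mem_insert_of_mem hm) n (Finset.mem_insert_of_mem hn)
    rw [Finset.sum_insert fun h => lt_irrefl b (hb b h)]
    by_cases hact : Active x b k
    · have hrest := sum_abs_le_of_active F hchain b hact fun n hn =>
        hF b (Finset.mem_insert_self b F) n (Finset.mem_insert_of_mem hn) (hb n hn)
      linarith [(C0.norm_apply_le (x b) k).trans (hM b)]
    · have hb_le : |x b k| ≤ (1 / 2 : ℝ) ^ b := not_lt.1 fun h => hact ⟨b, le_rfl, h⟩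
      have hrest := ih hchain (b + 1) fun n hn => hb n hn
      rw [pow_succ] at hrest
      linarith

theorem BIdeal.of_chain {x : ℕ → C₀(ℕ, ℝ)} {M : ℝ} (hM : ∀ n, ‖x n‖ ≤ M) {A : Set ℕ}
    (hA : ∀ m ∈ A, ∀ n ∈ A, m < n → Precedes x m n) : A ∈ BIdeal x := by
  have hM0 : 0 ≤ M := (norm_nonneg _).trans (hM 0)
  refine ⟨M + 2 + 2 * (1 / 2 : ℝ) ^ 0, fun F hF => C0.norm_le_of_forall (by positivity) fun k => ?_⟩
  rw [C0.sum_apply]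
  exact (Finset.abs_sum_le_sum_abs _ _).trans (sum_abs_le_of_chain hM F
    (fun m hm n hn => hA m (hF hm) n (hF hn)) 0 fun n _ => n.zero_le)

/-- Every relation on pairs `m < n` is given by a coloring of two-element sets. -/
theorem exists_pair_coloring (r : ℕ → ℕ → Prop) :
    ∃ c : Finset ℕ → Bool, ∀ m n, m < n → (c {m, n} = true ↔ r m n) := by
  classical
  refine ⟨fun s => decide (∃ m n, m < n ∧ s = {m, n} ∧ r m n), fun m n hmn => ?_⟩
  rw [decide_eq_true_iff]
  refine ⟨?_, fun h => ⟨m, n, hmn, rfl, h⟩⟩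
  rintro ⟨m', n', hlt, heq, h⟩
  have hm : m ∈ ({m', n'} : Finset ℕ) := heq ▸ by simp
  have hn : n ∈ ({m', n'} : Finset ℕ) := heq ▸ by simp
  simp only [Finset.mem_insert, Finset.mem_singleton] at hm hn
  obtain rfl : m = m' := by omega
  obtain rfl : n = n' := by omega
  exact h

theorem stmt19 (x : ℕ → C₀(ℕ, ℝ)) (htall : Tall (BIdeal x)) :
    ∃ c : Finset ℕ → Bool,
      Transitive (fun m n : ℕ => m < n ∧ c {m, n} = true) ∧
      (∀ A : Set ℕ, (∀ m ∈ A, ∀ n ∈ A, m < n → c {m, n} = false) → A.Finite) ∧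
      (∀ A : Set ℕ, (∃ b : Bool, ∀ m ∈ A, ∀ n ∈ A, m < n → c {m, n} = b) →
        A ∈ BIdeal x) := by
  obtain ⟨M, hM⟩ := htall.exists_norm_le
  obtain ⟨c, hc⟩ := exists_pair_coloring (Precedes x)
  have hfin : ∀ A : Set ℕ, (∀ m ∈ A, ∀ n ∈ A, m < n → c {m, n} = false) → A.Finite := by
    intro A hA
    rcases A.eq_empty_or_nonempty with rfl | ⟨m, hm⟩
    · exact Set.finite_empty
    refine (htall.finite_not_precedes m).subset fun n hn hmn => ?_
    have htrue := (hc m n hmn.1).2 hmn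
    rw [hA m hm n hn hmn.1] at htrue
    exact Bool.false_ne_true htrue
  refine ⟨c, ?_, hfin, ?_⟩
  · rintro l m n ⟨hlm, h₁⟩ ⟨hmn, h₂⟩
    have hln := hlm.trans hmn
    exact ⟨hln, (hc l n hln).2 (((hc l m hlm).1 h₁).trans ((hc m n hmn).1 h₂))⟩
  · rintro A ⟨b, hb⟩
    cases b with
    | false => exact BIdeal.of_finite x (hfin A hb)
    | true => exact BIdeal.of_chain hM fun m hm n hn hmn => (hc m n hmn).1 (hb m hm n hn hmn)
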